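/- Let ℓ ≥ 3 and let ī, j̄ ∈ ℤ/ℓℤ with j̄ = ī + 1 or j̄ = ī − 1 in ℤ/ℓℤ. Then the Misra–Miwa operators on the v-deformed Fock space F_v satisfy the quantum Serre relation F_ī² F_j̄ − (v + v⁻¹) F_ī F_j̄ F_ī + F_j̄ F_ī² = 0 as ℚ(v)-linear endomorphisms of F_v. -/

import Mathlib

open scoped Classical

namespace MisraMiwa

/-- The content of a box `b = (i, j)` (row `i`, column `j`, indexed from 0): column minus row. -/
def content (b : ℕ × ℕ) : ℤ := (b.2 : ℤ) - (b.1 : ℤ)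

/-- The color of a box: its content modulo `ℓ`. -/
def color (ℓ : ℕ) (b : ℕ × ℕ) : ZMod ℓ := (content b : ZMod ℓ)

/-- `b` is an addable box of the partition (Young diagram) `μ`. -/
def IsAddable (μ : YoungDiagram) (b : ℕ × ℕ) : Prop :=
  b ∉ μ ∧ ∃ ν : YoungDiagram, (ν : Set (ℕ × ℕ)) = insert b (μ : Set (ℕ × ℕ))

/-- `b` is a removable box of the partition (Young diagram) `μ`. -/
def IsRemovable (μ : YoungDiagram) (b : ℕ × ℕ) : Prop :=
  b ∈ μ ∧ ∃ ν : YoungDiagram, (ν : Set (ℕ × ℕ)) = (μ : Set (ℕ × ℕ)) \ {b}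

/-- The partition obtained from `μ` by adding the addable box `b`. -/
noncomputable def added (μ : YoungDiagram) (b : ℕ × ℕ) : YoungDiagram :=
  if h : IsAddable μ b then h.2.choose else μ

/-- The partition obtained from `μ` by removing the removable box `b`. -/
noncomputable def erased (μ : YoungDiagram) (b : ℕ × ℕ) : YoungDiagram :=
  if h : IsRemovable μ b then h.2.choose else μ

/-- `A ℓ i μ` : the set of addable boxes of `μ` of color `i`. -/
def A (ℓ : ℕ) (i : ZMod ℓ) (μ : YoungDiagram) : Set (ℕ × ℕ) :=
  {b | IsAddable μ b ∧ color ℓ b = i}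

/-- `R ℓ i μ` : the set of removable boxes of `μ` of color `i`. -/
def R (ℓ : ℕ) (i : ZMod ℓ) (μ : YoungDiagram) : Set (ℕ × ℕ) :=
  {b | IsRemovable μ b ∧ color ℓ b = i}

/-- `Nc ℓ i μ = #A_i(μ) - #R_i(μ)`. -/
noncomputable def Nc (ℓ : ℕ) (i : ZMod ℓ) (μ : YoungDiagram) : ℤ :=
  ((A ℓ i μ).ncard : ℤ) - ((R ℓ i μ).ncard : ℤ)

/-- `b'` is to the left of `b` : its content is strictly larger. -/
def LeftOf (b' b : ℕ × ℕ) : Prop := content b < content b'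

/-- `b'` is to the right of `b` : its content is strictly smaller. -/
def RightOf (b' b : ℕ × ℕ) : Prop := content b' < content b

/-- `Nl ℓ i μ b` : number of removable boxes of `μ` of color `i` to the left of `b`
minus number of addable boxes of `μ` of color `i` to the left of `b`. -/
noncomputable def Nl (ℓ : ℕ) (i : ZMod ℓ) (μ : YoungDiagram) (b : ℕ × ℕ) : ℤ :=
  ({b' | b' ∈ R ℓ i μ ∧ LeftOf b' b}.ncard : ℤ) - ({b' | b' ∈ A ℓ i μ ∧ LeftOf b' b}.ncard : ℤ)

/-- `Nr ℓ i μ b` : as `Nl`, but to the right of `b`. -/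
noncomputable def Nr (ℓ : ℕ) (i : ZMod ℓ) (μ : YoungDiagram) (b : ℕ × ℕ) : ℤ :=
  ({b' | b' ∈ R ℓ i μ ∧ RightOf b' b}.ncard : ℤ) - ({b' | b' ∈ A ℓ i μ ∧ RightOf b' b}.ncard : ℤ)

/-- The `v`-deformed Fock space: the `ℚ(v)`-vector space with basis indexed by partitions. -/
abbrev Fock : Type := YoungDiagram →₀ RatFunc ℚ

/-- The indeterminate `v` of `ℚ(v)`. -/
noncomputable def v : RatFunc ℚ := RatFunc.X

/-- `E_i |λ⟩ = Σ_μ v^(-N^r_i(λ/μ)) |μ⟩`, sum over `μ ⊂ λ` with `λ/μ` one box of color `i`. -/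
noncomputable def Evec (ℓ : ℕ) (i : ZMod ℓ) (lam : YoungDiagram) : Fock :=
  ∑ᶠ b ∈ R ℓ i lam,
    v ^ (-Nr ℓ i (erased lam b) b) • Finsupp.single (erased lam b) (1 : RatFunc ℚ)

/-- `F_i |λ⟩ = Σ_μ v^(N^l_i(μ/λ)) |μ⟩`, sum over `μ ⊃ λ` with `μ/λ` one box of color `i`. -/
noncomputable def Fvec (ℓ : ℕ) (i : ZMod ℓ) (lam : YoungDiagram) : Fock :=
  ∑ᶠ b ∈ A ℓ i lam,
    v ^ (Nl ℓ i lam b) • Finsupp.single (added lam b) (1 : RatFunc ℚ)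

/-- The Misra–Miwa operator `E_i`. -/
noncomputable def Eop (ℓ : ℕ) (i : ZMod ℓ) : Fock →ₗ[RatFunc ℚ] Fock :=
  Finsupp.lsum (RatFunc ℚ) fun lam => LinearMap.toSpanSingleton (RatFunc ℚ) Fock (Evec ℓ i lam)

/-- The Misra–Miwa operator `F_i`. -/
noncomputable def Fop (ℓ : ℕ) (i : ZMod ℓ) : Fock →ₗ[RatFunc ℚ] Fock :=
  Finsupp.lsum (RatFunc ℚ) fun lam => LinearMap.toSpanSingleton (RatFunc ℚ) Fock (Fvec ℓ i lam)

/-- The Misra–Miwa operator `K_i` : `K_i |λ⟩ = v^(N_i(λ)) |λ⟩`. -/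
noncomputable def Kop (ℓ : ℕ) (i : ZMod ℓ) : Fock →ₗ[RatFunc ℚ] Fock :=
  Finsupp.lsum (RatFunc ℚ) fun lam =>
    LinearMap.toSpanSingleton (RatFunc ℚ) Fock (v ^ Nc ℓ i lam • Finsupp.single lam (1 : RatFunc ℚ))

/-- The inverse operator `K_i⁻¹ |λ⟩ = v^(-N_i(λ)) |λ⟩`. -/
noncomputable def Kinvop (ℓ : ℕ) (i : ZMod ℓ) : Fock →ₗ[RatFunc ℚ] Fock :=
  Finsupp.lsum (RatFunc ℚ) fun lam =>
    LinearMap.toSpanSingleton (RatFunc ℚ) Fock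
      (v ^ (-Nc ℓ i lam) • Finsupp.single lam (1 : RatFunc ℚ))

/-- The Cartan matrix entry of affine type `A^{(1)}_{ℓ-1}`. -/
noncomputable def cartan (ℓ : ℕ) (i j : ZMod ℓ) : ℤ :=
  2 * (if i = j then 1 else 0)
    - (({1, -1} : Finset ℤ).filter (fun e => j = i + (e : ZMod ℓ))).card

/-- The `q`-integer `[n] = (q^n - q^{-n})/(q - q⁻¹)` in `ℚ(q)` (here `q = v`). -/
noncomputable def qint (n : ℤ) : RatFunc ℚ := (v ^ n - v ^ (-n)) / (v - v⁻¹)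

/-- `hasVal p x n` : the nonzero rational function `x` has `p`-adic valuation `n`. -/
def hasVal (p : Polynomial ℚ) (x : RatFunc ℚ) (n : ℤ) : Prop :=
  ∃ a b : Polynomial ℚ, ¬ p ∣ a ∧ ¬ p ∣ b ∧
    x = algebraMap (Polynomial ℚ) (RatFunc ℚ) p ^ n *
        (algebraMap (Polynomial ℚ) (RatFunc ℚ) a / algebraMap (Polynomial ℚ) (RatFunc ℚ) b)

/-- Addable boxes of `μ` in rows strictly above row `k` (rows indexed from 0). -/
def Alt (μ : YoungDiagram) (k : ℕ) : Set (ℕ × ℕ) := {b | IsAddable μ b ∧ b.1 < k}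

/-- Removable boxes of `μ` in rows strictly above row `k` (rows indexed from 0). -/
def Rlt (μ : YoungDiagram) (k : ℕ) : Set (ℕ × ℕ) := {b | IsRemovable μ b ∧ b.1 < k}

/-- The degree-`n` component of Fock space: the span of `|λ⟩` for `|λ| = n`. -/
noncomputable def degComp (n : ℕ) : Submodule (RatFunc ℚ) Fock :=
  Submodule.span (RatFunc ℚ)
    {f | ∃ lam : YoungDiagram, lam.card = n ∧ f = Finsupp.single lam (1 : RatFunc ℚ)}


/-- The beta set (Maya diagram) of a partition. -/
def beta (μ : YoungDiagram) : Set ℤ := {c | ∃ r : ℕ, c = (μ.rowLen r : ℤ) - r}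

lemma beta_aux_mono (μ : YoungDiagram) : StrictMono (fun r : ℕ => (r : ℤ) - μ.rowLen r) := by
  intro a b hab
  have := μ.rowLen_anti a b hab.le
  simp only
  omega

lemma eq_of_rowLen {μ ν : YoungDiagram} (h : ∀ r, μ.rowLen r = ν.rowLen r) : μ = ν := by
  apply SetLike.ext
  rintro ⟨r, s⟩
  rw [YoungDiagram.mem_iff_lt_rowLen, YoungDiagram.mem_iff_lt_rowLen, h]

lemma beta_injective : Function.Injective beta := by
  intro μ ν h
  have h1 : Set.range (fun r : ℕ => (r : ℤ) - μ.rowLen r)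
      = Set.range (fun r : ℕ => (r : ℤ) - ν.rowLen r) := by
    ext x
    have := Set.ext_iff.mp h (-x)
    simp only [beta, Set.mem_ofPred_eq] at this
    simp only [Set.mem_range]
    constructor
    · rintro ⟨r, hr⟩
      obtain ⟨r', hr'⟩ := this.mp ⟨r, by omega⟩
      exact ⟨r', by omega⟩
    · rintro ⟨r, hr⟩
      obtain ⟨r', hr'⟩ := this.mpr ⟨r, by omega⟩
      exact ⟨r', by omega⟩
  have h2 := (StrictMono.range_inj (beta_aux_mono μ) (beta_aux_mono ν)).mp h1
  apply eq_of_rowLen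
  intro r
  have := congrFun h2 r
  omega

lemma rowLen_insert {μ ν : YoungDiagram} {r : ℕ}
    (h : (ν : Set (ℕ × ℕ)) = insert (r, μ.rowLen r) (μ : Set (ℕ × ℕ))) (r' : ℕ) :
    ν.rowLen r' = μ.rowLen r' + if r' = r then 1 else 0 := by
  have key : ∀ s, s < ν.rowLen r' ↔ s < μ.rowLen r' + if r' = r then 1 else 0 := by
    intro s
    have := Set.ext_iff.mp h (r', s)
    simp only [SetLike.mem_coe, Set.mem_insert_iff, Prod.mk.injEq,
      YoungDiagram.mem_iff_lt_rowLen] at this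
    rw [this]
    split_ifs with hr
    · subst hr; omega
    · simp [hr]
  have h1 := key (ν.rowLen r')
  have h2 := key (μ.rowLen r' + if r' = r then 1 else 0)
  omega

lemma isAddable_iff (μ : YoungDiagram) (r s : ℕ) :
    IsAddable μ (r, s) ↔ s = μ.rowLen r ∧ (s : ℤ) - r + 1 ∉ beta μ := by
  constructor
  · rintro ⟨hb, ν, hν⟩
    have mem : ∀ x y, y < ν.rowLen x ↔ (x = r ∧ y = s) ∨ y < μ.rowLen x := by
      intro x y
      have := Set.ext_iff.mp hν (x, y)
      simpa only [SetLike.mem_coe, Set.mem_insert_iff, Prod.mk.injEq,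
        YoungDiagram.mem_iff_lt_rowLen] using this
    rw [YoungDiagram.mem_iff_lt_rowLen] at hb
    have hs : s = μ.rowLen r := by
      have h1 := (mem r s).mpr (Or.inl ⟨rfl, rfl⟩)
      have h2 := mem r (μ.rowLen r)
      omega
    refine ⟨hs, ?_⟩
    rintro ⟨r', hr'⟩
    have hlt : r' < r := by
      by_contra hc
      have := μ.rowLen_anti r r' (by omega)
      omega
    have h3 := μ.rowLen_anti r' (r - 1) (by omega)
    have h4 := ν.rowLen_anti (r - 1) r (by omega)
    have h1 := (mem r s).mpr (Or.inl ⟨rfl, rfl⟩)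
    have h5 := (mem (r - 1) s).mp (by omega)
    omega
  · rintro ⟨hs, hn⟩
    refine ⟨by rw [YoungDiagram.mem_iff_lt_rowLen]; omega, ?_⟩
    refine ⟨⟨insert (r, s) μ.cells, ?_⟩, ?_⟩
    · rintro ⟨x, y⟩ ⟨x', y'⟩ hle hm
      have hx : x' ≤ x := hle.1
      have hy : y' ≤ y := hle.2
      simp only [Finset.coe_insert, Set.mem_insert_iff, Prod.mk.injEq, Finset.mem_coe,
        YoungDiagram.mem_cells, YoungDiagram.mem_iff_lt_rowLen] at hm ⊢
      rcases hm with ⟨rfl, rfl⟩ | hm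
      · by_cases hxx : x' = x
        · subst hxx; omega
        · right
          have h1 := μ.rowLen_anti x' (x - 1) (by omega)
          have h2 := μ.rowLen_anti (x - 1) x (by omega)
          by_contra hc
          exact hn ⟨x - 1, by omega⟩
      · right
        have h1 := μ.rowLen_anti x' x hx
        omega
    · ext b
      simp [← YoungDiagram.mem_cells]

lemma isRemovable_iff (μ : YoungDiagram) (r s : ℕ) :
    IsRemovable μ (r, s) ↔ s + 1 = μ.rowLen r ∧ (s : ℤ) - r ∉ beta μ := by
  constructor
  · rintro ⟨hb, ν, hν⟩
    have mem : ∀ x y, y < ν.rowLen x ↔ y < μ.rowLen x ∧ ¬ (x = r ∧ y = s) := by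
      intro x y
      have := Set.ext_iff.mp hν (x, y)
      simpa only [SetLike.mem_coe, Set.mem_sdiff, Set.mem_singleton_iff, Prod.mk.injEq,
        YoungDiagram.mem_iff_lt_rowLen] using this
    rw [YoungDiagram.mem_iff_lt_rowLen] at hb
    have hns := mem r s
    have hs : s + 1 = μ.rowLen r := by
      have h2 := mem r (s + 1)
      omega
    refine ⟨hs, ?_⟩
    rintro ⟨r', hr'⟩
    have hlt : r < r' := by
      by_contra hc
      have := μ.rowLen_anti r' r (by omega)
      omega
    have h3 := μ.rowLen_anti (r + 1) r' (by omega)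
    have h4 := ν.rowLen_anti r (r + 1) (by omega)
    have h5 := (mem (r + 1) s)
    omega
  · rintro ⟨hs, hn⟩
    refine ⟨by rw [YoungDiagram.mem_iff_lt_rowLen]; omega, ?_⟩
    refine ⟨⟨μ.cells.erase (r, s), ?_⟩, ?_⟩
    · rintro ⟨x, y⟩ ⟨x', y'⟩ hle hm
      have hx : x' ≤ x := hle.1
      have hy : y' ≤ y := hle.2
      simp only [Finset.coe_erase, Set.mem_sdiff, Set.mem_singleton_iff, Prod.mk.injEq,
        Finset.mem_coe,
        YoungDiagram.mem_cells, YoungDiagram.mem_iff_lt_rowLen] at hm ⊢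
      have h1 := μ.rowLen_anti x' x hx
      refine ⟨by omega, ?_⟩
      rintro ⟨rfl, rfl⟩
      have hxx : x ≠ x' := by rintro rfl; omega
      have h2 := μ.rowLen_anti (x' + 1) x (by omega)
      have h3 := μ.rowLen_anti x' (x' + 1) (by omega)
      exact hn ⟨x' + 1, by push_cast; omega⟩
    · ext b
      rw [SetLike.mem_coe, ← YoungDiagram.mem_cells]
      simp [and_comm]

/-- Content `c` is addable. -/
def Ad (μ : YoungDiagram) (c : ℤ) : Prop := c ∈ beta μ ∧ c + 1 ∉ beta μ

lemma content_injOn_rows (μ : YoungDiagram) {r r' : ℕ}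
    (h : (μ.rowLen r : ℤ) - r = (μ.rowLen r' : ℤ) - r') : r = r' := by
  have := (beta_aux_mono μ).injective (a₁ := r) (a₂ := r') (by omega)
  exact this

lemma addable_content_inj (μ : YoungDiagram) {b b' : ℕ × ℕ} (h : IsAddable μ b)
    (h' : IsAddable μ b') (hc : content b = content b') : b = b' := by
  obtain ⟨r, s⟩ := b
  obtain ⟨r', s'⟩ := b'
  rw [isAddable_iff] at h h'
  simp only [content] at hc
  obtain ⟨rfl, -⟩ := h
  obtain ⟨rfl, -⟩ := h'
  rw [content_injOn_rows μ hc]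

lemma removable_content_inj (μ : YoungDiagram) {b b' : ℕ × ℕ} (h : IsRemovable μ b)
    (h' : IsRemovable μ b') (hc : content b = content b') : b = b' := by
  obtain ⟨r, s⟩ := b
  obtain ⟨r', s'⟩ := b'
  rw [isRemovable_iff] at h h'
  simp only [content] at hc
  have := content_injOn_rows μ (r := r) (r' := r') (by omega)
  subst this
  have : s = s' := by omega
  rw [this]

lemma ad_iff (μ : YoungDiagram) (c : ℤ) : Ad μ c ↔ ∃ b, IsAddable μ b ∧ content b = c := by
  constructor
  · rintro ⟨⟨r, hr⟩, h⟩
    refine ⟨(r, μ.rowLen r), ?_, hr.symm⟩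
    rw [isAddable_iff]
    exact ⟨rfl, by rwa [← hr]⟩
  · rintro ⟨⟨r, s⟩, h, rfl⟩
    rw [isAddable_iff] at h
    exact ⟨⟨r, by simp [content, h.1]⟩, h.2⟩

lemma rem_iff (μ : YoungDiagram) (c : ℤ) :
    (c + 1 ∈ beta μ ∧ c ∉ beta μ) ↔ ∃ b, IsRemovable μ b ∧ content b = c := by
  constructor
  · rintro ⟨⟨r, hr⟩, h⟩
    have hpos : 0 < μ.rowLen r := by
      by_contra hc
      have := μ.rowLen_anti r (r + 1) (by omega)
      exact h ⟨r + 1, by push_cast; omega⟩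
    have hcc : c = ((μ.rowLen r - 1 : ℕ) : ℤ) - r := by omega
    refine ⟨(r, μ.rowLen r - 1), ?_, hcc.symm⟩
    rw [isRemovable_iff]
    exact ⟨by omega, by rwa [← hcc]⟩
  · rintro ⟨⟨r, s⟩, h, rfl⟩
    rw [isRemovable_iff] at h
    exact ⟨⟨r, by simp only [content]; omega⟩, h.2⟩

lemma beta_added (μ : YoungDiagram) {b : ℕ × ℕ} (h : IsAddable μ b) :
    beta (added μ b) = insert (content b + 1) (beta μ \ {content b}) := by
  have hν : ((added μ b : YoungDiagram) : Set (ℕ × ℕ)) = insert b (μ : Set (ℕ × ℕ)) := by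
    rw [added, dif_pos h]
    exact h.2.choose_spec
  obtain ⟨r, s⟩ := b
  obtain ⟨rfl, hn⟩ := (isAddable_iff _ _ _).mp h
  have hr := rowLen_insert hν
  ext x
  simp only [beta, content, Set.mem_ofPred_eq, Set.mem_insert_iff, Set.mem_sdiff,
    Set.mem_singleton_iff]
  constructor
  · rintro ⟨r', hr'⟩
    rw [hr] at hr'
    by_cases hh : r' = r
    · subst hh; left; rw [if_pos rfl] at hr'; push_cast at hr'; omega
    · right
      rw [if_neg hh] at hr'
      refine ⟨⟨r', by simpa using hr'⟩, fun hc => hh ?_⟩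
      apply content_injOn_rows μ
      push_cast at hr'
      omega
  · rintro (hx | ⟨⟨r', hr'⟩, hne⟩)
    · exact ⟨r, by rw [hr, if_pos rfl]; push_cast; omega⟩
    · refine ⟨r', ?_⟩
      rw [hr, if_neg]
      · simpa using hr'
      · rintro rfl; exact hne hr'

/-- Add the addable box of content `c`. -/
noncomputable def ad (μ : YoungDiagram) (c : ℤ) : YoungDiagram :=
  if h : ∃ b, IsAddable μ b ∧ content b = c then added μ h.choose else μ

lemma ad_content (μ : YoungDiagram) {b : ℕ × ℕ} (h : IsAddable μ b) :
    ad μ (content b) = added μ b := by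
  have hex : ∃ b', IsAddable μ b' ∧ content b' = content b := ⟨b, h, rfl⟩
  rw [ad, dif_pos hex]
  rw [addable_content_inj μ hex.choose_spec.1 h hex.choose_spec.2]

lemma beta_ad (μ : YoungDiagram) {c : ℤ} (h : Ad μ c) :
    beta (ad μ c) = insert (c + 1) (beta μ \ {c}) := by
  obtain ⟨b, hb, rfl⟩ := (ad_iff μ c).mp h
  rw [ad_content μ hb, beta_added μ hb]

/-- The boundedness condition. -/
def Bnd (K : ℤ) (μ : YoungDiagram) : Prop :=
  (∀ x ∈ beta μ, x ≤ K) ∧ (∀ x, x ≤ -K → x ∈ beta μ)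

lemma exists_bnd (μ : YoungDiagram) : ∃ K, Bnd K μ := by
  refine ⟨(μ.rowLen 0 : ℤ) + μ.colLen 0, ?_, ?_⟩
  · rintro x ⟨r, hr⟩
    have := μ.rowLen_anti 0 r (by omega)
    omega
  · intro x hx
    refine ⟨x.natAbs, ?_⟩
    have h0 : μ.rowLen x.natAbs = 0 := by
      by_contra hc
      have h1 : (x.natAbs, 0) ∈ μ := by
        rw [YoungDiagram.mem_iff_lt_rowLen]; omega
      rw [YoungDiagram.mem_iff_lt_colLen] at h1
      omega
    omega

lemma Bnd.mono {K L : ℤ} {μ : YoungDiagram} (h : Bnd K μ) (hKL : K ≤ L) : Bnd L μ :=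
  ⟨fun x hx => (h.1 x hx).trans hKL, fun x hx => h.2 x (by omega)⟩

lemma Bnd.of_ad {K : ℤ} {μ : YoungDiagram} (h : Bnd K μ) {c : ℤ} (hc : Ad μ c) :
    -K ≤ c ∧ c ≤ K := by
  refine ⟨?_, h.1 _ hc.1⟩
  by_contra hlt
  exact hc.2 (h.2 _ (by omega))

lemma Bnd.ad {K : ℤ} {μ : YoungDiagram} (h : Bnd K μ) {c : ℤ} (hc : Ad μ c) :
    Bnd (K + 1) (ad μ c) := by
  obtain ⟨h1, h2⟩ := h.of_ad hc
  unfold Bnd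
  rw [beta_ad μ hc]
  constructor
  · intro x hx
    rcases hx with rfl | hx
    · omega
    · have := h.1 x hx.1
      omega
  · intro x hx
    right
    refine ⟨h.2 x (by omega), ?_⟩
    simp only [Set.mem_singleton_iff]
    omega

/-- Local weight. -/
noncomputable def nn (μ : YoungDiagram) (x : ℤ) : ℤ :=
  (if x + 1 ∈ beta μ then 1 else 0) - (if x ∈ beta μ then 1 else 0)

lemma Nl_eq (ℓ : ℕ) (i : ZMod ℓ) (μ : YoungDiagram) (b : ℕ × ℕ) (K : ℤ)
    (hK : ∀ x ∈ beta μ, x ≤ K) :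
    Nl ℓ i μ b = ∑ x ∈ Finset.Ioc (content b) K, if (x : ZMod ℓ) = i then nn μ x else 0 := by
  have hR : ({b' | b' ∈ R ℓ i μ ∧ LeftOf b' b}.ncard : ℤ) =
      ∑ x ∈ Finset.Ioc (content b) K,
        if (x : ZMod ℓ) = i ∧ x + 1 ∈ beta μ ∧ x ∉ beta μ then (1 : ℤ) else 0 := by
    rw [← Set.InjOn.ncard_image (f := content)
      (fun x hx y hy hxy => removable_content_inj μ hx.1.1 hy.1.1 hxy)]
    rw [← Finset.sum_filter, Finset.sum_const, nsmul_eq_mul, mul_one, ← Set.ncard_coe_finset]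
    congr 2
    ext x
    simp only [Set.mem_image, Set.mem_ofPred_eq, R, LeftOf, color, Finset.coe_filter,
      Finset.mem_Ioc, rem_iff]
    constructor
    · rintro ⟨b', ⟨⟨h1, h2⟩, h3⟩, rfl⟩
      have := hK _ ((rem_iff μ (content b')).mpr ⟨b', h1, rfl⟩).1
      exact ⟨⟨h3, by omega⟩, h2, b', h1, rfl⟩
    · rintro ⟨⟨h1, h2⟩, h3, b', h4, rfl⟩
      exact ⟨b', ⟨⟨h4, h3⟩, h1⟩, rfl⟩
  have hA : ({b' | b' ∈ A ℓ i μ ∧ LeftOf b' b}.ncard : ℤ) =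
      ∑ x ∈ Finset.Ioc (content b) K,
        if (x : ZMod ℓ) = i ∧ Ad μ x then (1 : ℤ) else 0 := by
    rw [← Set.InjOn.ncard_image (f := content)
      (fun x hx y hy hxy => addable_content_inj μ hx.1.1 hy.1.1 hxy)]
    rw [← Finset.sum_filter, Finset.sum_const, nsmul_eq_mul, mul_one, ← Set.ncard_coe_finset]
    congr 2
    ext x
    simp only [Set.mem_image, Set.mem_ofPred_eq, A, LeftOf, color, Finset.coe_filter,
      Finset.mem_Ioc, ad_iff]
    constructor
    · rintro ⟨b', ⟨⟨h1, h2⟩, h3⟩, rfl⟩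
      have := hK _ ((ad_iff μ (content b')).mpr ⟨b', h1, rfl⟩).1
      exact ⟨⟨h3, by omega⟩, h2, b', h1, rfl⟩
    · rintro ⟨⟨h1, h2⟩, h3, b', h4, rfl⟩
      exact ⟨b', ⟨⟨h4, h3⟩, h1⟩, rfl⟩
  rw [Nl, hR, hA, ← Finset.sum_sub_distrib]
  apply Finset.sum_congr rfl
  intro x _
  by_cases h1 : (x : ZMod ℓ) = i <;> by_cases h2 : x ∈ beta μ <;> by_cases h3 : x + 1 ∈ beta μ <;>
    simp [h1, h2, h3, nn, Ad]

lemma nn_ad (μ : YoungDiagram) {d : ℤ} (h : Ad μ d) (x : ℤ) :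
    nn (ad μ d) x = nn μ x + (if x = d then 2 else 0) - (if x = d - 1 then 1 else 0)
      - (if x = d + 1 then 1 else 0) := by
  obtain ⟨h1, h2⟩ := id h
  unfold nn
  rw [beta_ad μ h]
  simp only [Set.mem_insert_iff, Set.mem_sdiff, Set.mem_singleton_iff]
  by_cases e1 : x = d
  · subst e1
    have a : x ≠ x - 1 := by omega
    simp [h1, h2, a]
  by_cases e2 : x = d - 1
  · subst e2
    have a : d - 1 ≠ d + 1 := by omega
    have b : d - 1 ≠ d := by omega
    simp [h1, a, b]
  by_cases e3 : x = d + 1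
  · subst e3
    have a : d + 1 ≠ d - 1 := by omega
    have b : d + 1 + 1 ≠ d := by omega
    simp [h2, a, b]
  have e4 : x + 1 ≠ d := by omega
  simp [e1, e2, e3, e4]

/-- Weight shift at content `c` after adding a box of content `d`. -/
noncomputable def sh (ℓ : ℕ) (d c : ℤ) : ℤ :=
  (if c < d ∧ (d : ZMod ℓ) = c then 2 else 0)
    - (if c < d - 1 ∧ ((d - 1 : ℤ) : ZMod ℓ) = c then 1 else 0)
    - (if c < d + 1 ∧ ((d + 1 : ℤ) : ZMod ℓ) = c then 1 else 0)

/-- The weight as a function of the content. -/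
noncomputable def NN (ℓ : ℕ) (μ : YoungDiagram) (c : ℤ) : ℤ :=
  Nl ℓ (c : ZMod ℓ) μ ((-c).toNat, c.toNat)

lemma Nl_eq_NN (ℓ : ℕ) (μ : YoungDiagram) (b : ℕ × ℕ) :
    Nl ℓ (color ℓ b) μ b = NN ℓ μ (content b) := by
  have h : content ((-(content b)).toNat, (content b).toNat) = content b := by
    unfold content
    simp only
    omega
  unfold NN Nl LeftOf
  rw [h]
  rfl

lemma NN_eq (ℓ : ℕ) (μ : YoungDiagram) (c : ℤ) (K : ℤ)
    (hK : ∀ x ∈ beta μ, x ≤ K) :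
    NN ℓ μ c = ∑ x ∈ Finset.Ioc c K, if (x : ZMod ℓ) = c then nn μ x else 0 := by
  have h : content ((-c).toNat, c.toNat) = c := by
    unfold content
    simp only
    omega
  rw [NN, Nl_eq ℓ _ μ _ K hK, h]

lemma NN_ad (ℓ : ℕ) (μ : YoungDiagram) {d : ℤ} (h : Ad μ d) (c : ℤ) :
    NN ℓ (ad μ d) c = NN ℓ μ c + sh ℓ d c := by
  obtain ⟨K, hK⟩ := exists_bnd μ
  have h2 := (hK.of_ad h).2
  have hK1 := hK.ad h
  rw [NN_eq ℓ (ad μ d) c (K + 1) hK1.1, NN_eq ℓ μ c (K + 1) (hK.mono (by omega)).1]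
  have e : ∀ x : ℤ, (if (x : ZMod ℓ) = c then nn (ad μ d) x else 0) =
      (if (x : ZMod ℓ) = c then nn μ x else 0)
      + (if x = d then (if (d : ZMod ℓ) = c then 2 else 0) else 0)
      - (if x = d - 1 then (if ((d - 1 : ℤ) : ZMod ℓ) = c then 1 else 0) else 0)
      - (if x = d + 1 then (if ((d + 1 : ℤ) : ZMod ℓ) = c then 1 else 0) else 0) := by
    intro x
    rw [nn_ad μ h]
    by_cases e1 : x = d
    · subst e1; split_ifs <;> omega
    by_cases e2 : x = d - 1
    · subst e2; split_ifs <;> omega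
    by_cases e3 : x = d + 1
    · subst e3; split_ifs <;> omega
    simp [e1, e2, e3]
  simp only [e, Finset.sum_sub_distrib, Finset.sum_add_distrib, Finset.sum_ite_eq',
    Finset.mem_Ioc, sh, ite_and]
  have a1 : d ≤ K + 1 := by omega
  have a2 : d - 1 ≤ K + 1 := by omega
  have a3 : d + 1 ≤ K + 1 := by omega
  simp only [a1, a2, a3, if_true]
  ring

/-- Weighted box addition on basis vectors. -/
noncomputable def Gvec (ℓ : ℕ) (c : ℤ) (μ : YoungDiagram) : Fock :=
  if Ad μ c then v ^ (NN ℓ μ c) • Finsupp.single (ad μ c) (1 : RatFunc ℚ) else 0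

/-- Weighted box addition operator. -/
noncomputable def G (ℓ : ℕ) (c : ℤ) : Module.End (RatFunc ℚ) Fock :=
  Finsupp.lsum (RatFunc ℚ) fun lam => LinearMap.toSpanSingleton (RatFunc ℚ) Fock (Gvec ℓ c lam)

lemma G_single (ℓ : ℕ) (c : ℤ) (μ : YoungDiagram) :
    G ℓ c (Finsupp.single μ 1) = Gvec ℓ c μ := by
  simp [G]

lemma Fop_single (ℓ : ℕ) (i : ZMod ℓ) (μ : YoungDiagram) :
    Fop ℓ i (Finsupp.single μ 1) = Fvec ℓ i μ := by
  simp [Fop]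

lemma v_ne : v ≠ 0 := RatFunc.X_ne_zero

lemma Ad_ad_far {μ : YoungDiagram} {c d : ℤ} (h : Ad μ d) (hcd : c + 2 ≤ d ∨ d + 2 ≤ c) :
    Ad (ad μ d) c ↔ Ad μ c := by
  unfold Ad
  rw [beta_ad μ h]
  simp only [Set.mem_insert_iff, Set.mem_sdiff, Set.mem_singleton_iff]
  have h1 : c ≠ d := by omega
  have h2 : c ≠ d + 1 := by omega
  have h3 : c + 1 ≠ d := by omega
  have h4 : c + 1 ≠ d + 1 := by omega
  simp [h1, h2, h3]

lemma GG_single (ℓ : ℕ) (c d : ℤ) (μ : YoungDiagram) :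
    G ℓ c (G ℓ d (Finsupp.single μ 1)) = if Ad μ d ∧ Ad (ad μ d) c then
      v ^ (NN ℓ μ d + NN ℓ μ c + sh ℓ d c) • Finsupp.single (ad (ad μ d) c) (1 : RatFunc ℚ)
      else 0 := by
  rw [G_single, Gvec]
  by_cases h : Ad μ d
  · rw [if_pos h, map_smul, G_single, Gvec]
    by_cases h' : Ad (ad μ d) c
    · rw [if_pos h', if_pos ⟨h, h'⟩, NN_ad ℓ μ h, smul_smul, ← zpow_add₀ v_ne, add_assoc]
    · rw [if_neg h', if_neg (fun hh => h' hh.2), smul_zero]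
  · rw [if_neg h, if_neg (fun hh => h hh.1), map_zero]

lemma G_ext {S T : Module.End (RatFunc ℚ) Fock}
    (h : ∀ μ, S (Finsupp.single μ 1) = T (Finsupp.single μ 1)) : S = T := by
  apply Finsupp.lhom_ext'
  intro μ
  apply LinearMap.ext_ring
  exact h μ

lemma G_comm (ℓ : ℕ) {c d : ℤ} (hcd : c + 2 ≤ d ∨ d + 2 ≤ c) {t : ℤ}
    (ht : sh ℓ d c - sh ℓ c d = t) :
    G ℓ c * G ℓ d = v ^ t • (G ℓ d * G ℓ c) := by
  apply G_ext
  intro μ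
  rw [LinearMap.smul_apply, Module.End.mul_apply, Module.End.mul_apply, GG_single, GG_single]
  by_cases h1 : Ad μ d
  · by_cases h2 : Ad μ c
    · have h3 := (Ad_ad_far h1 hcd).mpr h2
      have h4 := (Ad_ad_far h2 hcd.symm).mpr h1
      rw [if_pos ⟨h1, h3⟩, if_pos ⟨h2, h4⟩, smul_smul, ← zpow_add₀ v_ne]
      have e : ad (ad μ d) c = ad (ad μ c) d := by
        apply beta_injective
        rw [beta_ad _ h3, beta_ad _ h4, beta_ad _ h1, beta_ad _ h2]
        ext x
        simp only [Set.mem_insert_iff, Set.mem_sdiff, Set.mem_singleton_iff]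
        by_cases e1 : x = c
        · subst e1; simp; omega
        by_cases e2 : x = d
        · subst e2; simp; omega
        tauto
      rw [e]
      congr 2
      omega
    · rw [if_neg, if_neg, smul_zero]
      · exact fun hh => h2 hh.1
      · exact fun hh => h2 ((Ad_ad_far h1 hcd).mp hh.2)
  · rw [if_neg, if_neg, smul_zero]
    · exact fun hh => h1 ((Ad_ad_far hh.1 hcd.symm).mp hh.2)
    · exact fun hh => h1 hh.1

lemma G_sq (ℓ : ℕ) (c : ℤ) : G ℓ c * G ℓ c = 0 := by
  apply G_ext
  intro μ
  rw [Module.End.mul_apply, GG_single, if_neg]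
  · rfl
  · rintro ⟨h, h'⟩
    have := h'.1
    rw [beta_ad μ h] at this
    simp at this

lemma G_braid (ℓ : ℕ) (c d : ℤ) (hd : d = c + 1 ∨ d = c - 1) :
    G ℓ c * (G ℓ d * G ℓ c) = 0 := by
  apply G_ext
  intro μ
  rw [Module.End.mul_apply, Module.End.mul_apply, GG_single]
  split_ifs with h
  · obtain ⟨h1, h2⟩ := h
    rw [map_smul, G_single, Gvec, if_neg, smul_zero]
    · rfl
    · rintro ⟨h3, h4⟩
      rw [beta_ad _ h2, beta_ad _ h1] at h3 h4
      rcases hd with rfl | rfl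
      · simp at h3
        omega
      · simp at h4
        omega
  · simp

lemma serre_alg {k M : Type*} [Field k] [Ring M] [Algebra k M] (q : k) (hq : q ≠ 0) (x y z : M)
    (hyx : y * x = q ^ 2 • (x * y)) (e f : ℤ) (hx : x * z = q ^ e • (z * x) ∨ e = 0)
    (hy : y * z = q ^ f • (z * y) ∨ f = 0) (hef : (e = -1 ∧ f = -1) ∨ (e = 1 ∧ f = -1) ∨
      (e = 1 ∧ f = 1) ∨ (e = 0 ∧ f = -1) ∨ (e = 1 ∧ f = 0)) :
    x * (y * z) + y * (x * z) - (q + q⁻¹) • (x * (z * y) + y * (z * x))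
      + (z * (x * y) + z * (y * x)) = 0 := by
  have hyx' : ∀ w, y * (x * w) = q ^ 2 • (x * (y * w)) := by
    intro w; rw [← mul_assoc, hyx, smul_mul_assoc, mul_assoc]
  rcases hef with ⟨rfl, rfl⟩ | ⟨rfl, rfl⟩ | ⟨rfl, rfl⟩ | ⟨rfl, rfl⟩ | ⟨rfl, rfl⟩
  · have hx := hx.resolve_right (by decide)
    have hy := hy.resolve_right (by decide)
    have hx' : ∀ w, x * (z * w) = q ^ (-1 : ℤ) • (z * (x * w)) := by
      intro w; rw [← mul_assoc, hx, smul_mul_assoc, mul_assoc]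
    have hy' : ∀ w, y * (z * w) = q ^ (-1 : ℤ) • (z * (y * w)) := by
      intro w; rw [← mul_assoc, hy, smul_mul_assoc, mul_assoc]
    simp only [hx', hy', hx, hy, hyx, mul_smul_comm, zpow_neg_one]
    match_scalars
    field_simp
    ring
  · have hx := hx.resolve_right (by decide)
    have hy := hy.resolve_right (by decide)
    have hx' : ∀ w, x * (z * w) = q ^ (1 : ℤ) • (z * (x * w)) := by
      intro w; rw [← mul_assoc, hx, smul_mul_assoc, mul_assoc]
    have hy' : ∀ w, y * (z * w) = q ^ (-1 : ℤ) • (z * (y * w)) := by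
      intro w; rw [← mul_assoc, hy, smul_mul_assoc, mul_assoc]
    simp only [hx', hy', hx, hy, hyx, mul_smul_comm, zpow_neg_one, zpow_one]
    match_scalars
    field_simp
    ring
  · have hx := hx.resolve_right (by decide)
    have hy := hy.resolve_right (by decide)
    have hx' : ∀ w, x * (z * w) = q ^ (1 : ℤ) • (z * (x * w)) := by
      intro w; rw [← mul_assoc, hx, smul_mul_assoc, mul_assoc]
    have hy' : ∀ w, y * (z * w) = q ^ (1 : ℤ) • (z * (y * w)) := by
      intro w; rw [← mul_assoc, hy, smul_mul_assoc, mul_assoc]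
    simp only [hx', hy', hx, hy, hyx, mul_smul_comm, zpow_one]
    match_scalars
    field_simp
    ring
  · have hy := hy.resolve_right (by decide)
    have hy' : ∀ w, y * (z * w) = q ^ (-1 : ℤ) • (z * (y * w)) := by
      intro w; rw [← mul_assoc, hy, smul_mul_assoc, mul_assoc]
    simp only [hyx', hy', hy, hyx, mul_smul_comm, zpow_neg_one]
    match_scalars <;> field_simp <;> ring
  · have hx := hx.resolve_right (by decide)
    have hx' : ∀ w, x * (z * w) = q ^ (1 : ℤ) • (z * (x * w)) := by
      intro w; rw [← mul_assoc, hx, smul_mul_assoc, mul_assoc]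
    have hyx2 : x * y = (q ^ 2)⁻¹ • (y * x) := by
      rw [hyx, smul_smul, inv_mul_cancel₀ (pow_ne_zero 2 hq), one_smul]
    have hyx3 : ∀ w, x * (y * w) = (q ^ 2)⁻¹ • (y * (x * w)) := by
      intro w; rw [← mul_assoc, hyx2, smul_mul_assoc, mul_assoc]
    simp only [hyx3, hx', hx, hyx2, mul_smul_comm, zpow_one]
    match_scalars <;> field_simp <;> ring

lemma serre_eq {k M : Type*} [Field k] [Ring M] [Algebra k M] (q : k) (x z : M)
    (hx : x * x = 0) (hz : x * (z * x) = 0) :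
    x * (x * z) + x * (x * z) - (q + q⁻¹) • (x * (z * x) + x * (z * x))
      + (z * (x * x) + z * (x * x)) = 0 := by
  rw [hz, hx, ← mul_assoc, hx]
  simp

lemma sum_serre {k M : Type*} [Field k] [CharZero k] [Ring M] [Algebra k M] (q : k) (g : ℤ → M)
    (S T : Finset ℤ)
    (H : ∀ a ∈ S, ∀ b ∈ S, ∀ d ∈ T, g a * (g b * g d) + g b * (g a * g d)
      - (q + q⁻¹) • (g a * (g d * g b) + g b * (g d * g a))
      + (g d * (g a * g b) + g d * (g b * g a)) = 0) :
    (∑ c ∈ S, g c) * ((∑ c ∈ S, g c) * (∑ c ∈ T, g c))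
      - (q + q⁻¹) • ((∑ c ∈ S, g c) * ((∑ c ∈ T, g c) * (∑ c ∈ S, g c)))
      + (∑ c ∈ T, g c) * ((∑ c ∈ S, g c) * (∑ c ∈ S, g c)) = 0 := by
  have key : ∑ a ∈ S, ∑ b ∈ S, ∑ d ∈ T, (g a * (g b * g d) + g b * (g a * g d)
      - (q + q⁻¹) • (g a * (g d * g b) + g b * (g d * g a))
      + (g d * (g a * g b) + g d * (g b * g a))) = 0 :=
    Finset.sum_eq_zero fun a ha => Finset.sum_eq_zero fun b hb =>
      Finset.sum_eq_zero fun d hd => H a ha b hb d hd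
  have gen : ∀ U V W : Finset ℤ, (∑ c ∈ U, g c) * ((∑ c ∈ V, g c) * (∑ c ∈ W, g c))
      = ∑ a ∈ U, ∑ b ∈ V, ∑ d ∈ W, g a * (g b * g d) := by
    intro U V W
    rw [Finset.sum_mul]
    refine Finset.sum_congr rfl fun a _ => ?_
    rw [Finset.sum_mul, Finset.mul_sum]
    refine Finset.sum_congr rfl fun b _ => ?_
    rw [Finset.mul_sum, Finset.mul_sum]
  have e1 := gen S S T
  have e1' : _ = ∑ a ∈ S, ∑ b ∈ S, ∑ d ∈ T, g b * (g a * g d) := e1.trans Finset.sum_comm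
  have e2 : _ = ∑ a ∈ S, ∑ b ∈ S, ∑ d ∈ T, g a * (g d * g b) :=
    (gen S T S).trans (Finset.sum_congr rfl fun a _ => Finset.sum_comm)
  have e2' : _ = ∑ a ∈ S, ∑ b ∈ S, ∑ d ∈ T, g b * (g d * g a) := e2.trans Finset.sum_comm
  have e3 : _ = ∑ a ∈ S, ∑ b ∈ S, ∑ d ∈ T, g d * (g a * g b) :=
    ((gen T S S).trans Finset.sum_comm).trans (Finset.sum_congr rfl fun a _ => Finset.sum_comm)
  have e3' : _ = ∑ a ∈ S, ∑ b ∈ S, ∑ d ∈ T, g d * (g b * g a) := e3.trans Finset.sum_comm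
  simp only [Finset.sum_add_distrib, Finset.sum_sub_distrib, ← Finset.smul_sum] at key
  rw [← e1, ← e1', ← e2, ← e2', ← e3, ← e3'] at key
  generalize (∑ c ∈ S, g c) * ((∑ c ∈ S, g c) * (∑ c ∈ T, g c)) = X at key ⊢
  generalize (∑ c ∈ S, g c) * ((∑ c ∈ T, g c) * (∑ c ∈ S, g c)) = Y at key ⊢
  generalize (∑ c ∈ T, g c) * ((∑ c ∈ S, g c) * (∑ c ∈ S, g c)) = Z at key ⊢
  have h2 : (2 : k) • (X - (q + q⁻¹) • Y + Z) = 0 := by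
    rw [← key]
    module
  have h3 := congrArg (fun w => (2 : k)⁻¹ • w) h2
  simpa [smul_smul] using h3

lemma cast_ne (ℓ : ℕ) (hℓ : 3 ≤ ℓ) {x y : ℤ} (h : (x : ZMod ℓ) = y) (t : ℤ)
    (ht : t = 1 ∨ t = -1 ∨ t = 2 ∨ t = -2) {z : ℤ} (hz : z = x + t) : (z : ZMod ℓ) ≠ y := by
  subst hz
  rw [← h]
  intro hc
  rw [ZMod.intCast_eq_intCast_iff_dvd_sub] at hc
  have h1 : (ℓ : ℤ) ∣ t := by
    have : x - (x + t) = -t := by ring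
    rw [this] at hc
    exact (dvd_neg.mp hc)
  have h2 := Int.natAbs_dvd_natAbs.mpr h1
  have h3 := Nat.le_of_dvd (by omega) h2
  simp at h3
  omega

lemma far_of_ne (ℓ : ℕ) (hℓ : 3 ≤ ℓ) {a b : ℤ} (h : (a : ZMod ℓ) = b) (hab : a < b) :
    a + 3 ≤ b := by
  rw [ZMod.intCast_eq_intCast_iff_dvd_sub] at h
  have := Int.le_of_dvd (by omega) h
  omega

lemma sh_same_lt (ℓ : ℕ) (hℓ : 3 ≤ ℓ) {a b : ℤ} (h : (a : ZMod ℓ) = b) (hab : b < a) :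
    sh ℓ a b = 2 := by
  have h1 := cast_ne ℓ hℓ h (-1) (by simp) (z := a - 1) (by ring)
  have h2 := cast_ne ℓ hℓ h 1 (by simp) (z := a + 1) (by ring)
  rw [sh, if_pos ⟨hab, h⟩, if_neg (fun hh => h1 hh.2), if_neg (fun hh => h2 hh.2)]
  rfl

lemma sh_same_gt (ℓ : ℕ) (hℓ : 3 ≤ ℓ) {a b : ℤ} (h : (a : ZMod ℓ) = b) (hab : b < a) :
    sh ℓ b a = 0 := by
  have h1 := cast_ne ℓ hℓ h.symm (-1) (by simp) (z := b - 1) (by ring)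
  have h2 := cast_ne ℓ hℓ h.symm 1 (by simp) (z := b + 1) (by ring)
  rw [sh, if_neg (by omega), if_neg (fun hh => h1 hh.2), if_neg (fun hh => h2 hh.2)]
  rfl

lemma sh_adj1 (ℓ : ℕ) (hℓ : 3 ≤ ℓ) {a p d : ℤ} (h : (a : ZMod ℓ) = p)
    (hd : d = p + 1 ∨ d = p - 1) : sh ℓ d a = if a < p then -1 else 0 := by
  rcases hd with rfl | rfl
  · have h1 := cast_ne ℓ hℓ h.symm 1 (by simp) (z := p + 1) (by ring)
    have h2 := cast_ne ℓ hℓ h.symm 2 (by simp) (z := p + 1 + 1) (by ring)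
    rw [sh, if_neg (fun hh => h1 hh.2), if_neg (c := a < p + 1 + 1 ∧ _) (fun hh => h2 hh.2)]
    simp only [add_sub_cancel_right, h, and_true]
    split_ifs <;> rfl
  · have h1 := cast_ne ℓ hℓ h.symm (-1) (by simp) (z := p - 1) (by ring)
    have h2 := cast_ne ℓ hℓ h.symm (-2) (by simp) (z := p - 1 - 1) (by ring)
    rw [sh, if_neg (fun hh => h1 hh.2), if_neg (c := a < p - 1 - 1 ∧ _) (fun hh => h2 hh.2)]
    simp only [sub_add_cancel, h, and_true]
    split_ifs <;> rfl

lemma sh_adj2 (ℓ : ℕ) (hℓ : 3 ≤ ℓ) {a p d : ℤ} (h : (a : ZMod ℓ) = p)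
    (hd : d = p + 1 ∨ d = p - 1) : sh ℓ a d = if p < a then -1 else 0 := by
  rcases hd with rfl | rfl
  · have h1 : (a : ZMod ℓ) ≠ ((p + 1 : ℤ) : ZMod ℓ) := by
      rw [h]; exact (cast_ne ℓ hℓ rfl 1 (by simp) rfl).symm
    have h2 : ((a - 1 : ℤ) : ZMod ℓ) ≠ ((p + 1 : ℤ) : ZMod ℓ) := by
      refine (cast_ne ℓ hℓ (x := a - 1) (y := a - 1) rfl 2 (by simp) rfl).symm.trans_eq ?_
      push_cast
      rw [h]; ring
    have h3 : ((a + 1 : ℤ) : ZMod ℓ) = ((p + 1 : ℤ) : ZMod ℓ) := by push_cast; rw [h]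
    rw [sh, if_neg (fun hh => h1 hh.2), if_neg (c := p + 1 < a - 1 ∧ _) (fun hh => h2 hh.2)]
    simp only [h3, and_true, add_lt_add_iff_right]
    split_ifs <;> rfl
  · have h1 : (a : ZMod ℓ) ≠ ((p - 1 : ℤ) : ZMod ℓ) := by
      rw [h]; exact (cast_ne ℓ hℓ rfl (-1) (by simp) rfl).symm
    have h2 : ((a + 1 : ℤ) : ZMod ℓ) ≠ ((p - 1 : ℤ) : ZMod ℓ) := by
      refine (cast_ne ℓ hℓ (x := a + 1) (y := a + 1) rfl (-2) (by simp) rfl).symm.trans_eq ?_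
      push_cast
      rw [h]; ring
    have h3 : ((a - 1 : ℤ) : ZMod ℓ) = ((p - 1 : ℤ) : ZMod ℓ) := by push_cast; rw [h]
    rw [sh, if_neg (fun hh => h1 hh.2), if_neg (c := p - 1 < a + 1 ∧ _) (fun hh => h2 hh.2)]
    simp only [h3, and_true, sub_lt_sub_iff_right]
    split_ifs <;> rfl

lemma G_adj_lt (ℓ : ℕ) (hℓ : 3 ≤ ℓ) {a p d : ℤ} (h : (a : ZMod ℓ) = p)
    (hd : d = p + 1 ∨ d = p - 1) (hap : a < p) :
    G ℓ a * G ℓ d = v ^ (-1 : ℤ) • (G ℓ d * G ℓ a) := by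
  have := far_of_ne ℓ hℓ h hap
  apply G_comm ℓ (by omega)
  rw [sh_adj1 ℓ hℓ h hd, sh_adj2 ℓ hℓ h hd, if_pos hap, if_neg (by omega)]
  rfl

lemma G_adj_gt (ℓ : ℕ) (hℓ : 3 ≤ ℓ) {a p d : ℤ} (h : (a : ZMod ℓ) = p)
    (hd : d = p + 1 ∨ d = p - 1) (hap : p < a) :
    G ℓ a * G ℓ d = v ^ (1 : ℤ) • (G ℓ d * G ℓ a) := by
  have := far_of_ne ℓ hℓ h.symm hap
  apply G_comm ℓ (by omega)
  rw [sh_adj1 ℓ hℓ h hd, sh_adj2 ℓ hℓ h hd, if_pos hap, if_neg (by omega)]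
  rfl

lemma G_same (ℓ : ℕ) (hℓ : 3 ≤ ℓ) {a b : ℤ} (h : (a : ZMod ℓ) = b) (hab : b < a) :
    G ℓ b * G ℓ a = v ^ 2 • (G ℓ a * G ℓ b) := by
  have := far_of_ne ℓ hℓ h.symm hab
  have := G_comm ℓ (c := b) (d := a) (by omega) (t := 2)
    (by rw [sh_same_lt ℓ hℓ h hab, sh_same_gt ℓ hℓ h hab]; rfl)
  exact_mod_cast this

lemma local_lt (ℓ : ℕ) (hℓ : 3 ≤ ℓ) {a b p d : ℤ} (ha : (a : ZMod ℓ) = p) (hb : (b : ZMod ℓ) = p)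
    (hd : d = p + 1 ∨ d = p - 1) (hab : b < a) :
    G ℓ a * (G ℓ b * G ℓ d) + G ℓ b * (G ℓ a * G ℓ d)
      - (v + v⁻¹) • (G ℓ a * (G ℓ d * G ℓ b) + G ℓ b * (G ℓ d * G ℓ a))
      + (G ℓ d * (G ℓ a * G ℓ b) + G ℓ d * (G ℓ b * G ℓ a)) = 0 := by
  have hba := G_same ℓ hℓ (ha.trans hb.symm) hab
  rcases lt_trichotomy p b with h1 | h1 | h1
  · exact serre_alg (M := Module.End (RatFunc ℚ) Fock) v v_ne _ _ _ hba 1 1 (Or.inl (G_adj_gt ℓ hℓ ha hd (by omega)))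
      (Or.inl (G_adj_gt ℓ hℓ hb hd (by omega))) (by simp)
  · exact serre_alg (M := Module.End (RatFunc ℚ) Fock) v v_ne _ _ _ hba 1 0 (Or.inl (G_adj_gt ℓ hℓ ha hd (by omega)))
      (Or.inr rfl) (by simp)
  · rcases lt_trichotomy p a with h2 | h2 | h2
    · exact serre_alg (M := Module.End (RatFunc ℚ) Fock) v v_ne _ _ _ hba 1 (-1) (Or.inl (G_adj_gt ℓ hℓ ha hd (by omega)))
        (Or.inl (G_adj_lt ℓ hℓ hb hd (by omega))) (by simp)
    · exact serre_alg (M := Module.End (RatFunc ℚ) Fock) v v_ne _ _ _ hba 0 (-1) (Or.inr rfl)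
        (Or.inl (G_adj_lt ℓ hℓ hb hd (by omega))) (by simp)
    · exact serre_alg (M := Module.End (RatFunc ℚ) Fock) v v_ne _ _ _ hba (-1) (-1) (Or.inl (G_adj_lt ℓ hℓ ha hd (by omega)))
        (Or.inl (G_adj_lt ℓ hℓ hb hd (by omega))) (by simp)

lemma G_aba (ℓ : ℕ) (hℓ : 3 ≤ ℓ) {a p d : ℤ} (ha : (a : ZMod ℓ) = p)
    (hd : d = p + 1 ∨ d = p - 1) : G ℓ a * (G ℓ d * G ℓ a) = 0 := by
  rcases lt_trichotomy p a with h | h | h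
  · rw [← mul_assoc, G_adj_gt ℓ hℓ ha hd h, smul_mul_assoc, mul_assoc, G_sq, mul_zero, smul_zero]
  · subst h; exact G_braid ℓ p d hd
  · rw [← mul_assoc, G_adj_lt ℓ hℓ ha hd h, smul_mul_assoc, mul_assoc, G_sq, mul_zero, smul_zero]

lemma local_all (ℓ : ℕ) (hℓ : 3 ≤ ℓ) {a b p d : ℤ} (ha : (a : ZMod ℓ) = p) (hb : (b : ZMod ℓ) = p)
    (hd : d = p + 1 ∨ d = p - 1) :
    G ℓ a * (G ℓ b * G ℓ d) + G ℓ b * (G ℓ a * G ℓ d)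
      - (v + v⁻¹) • (G ℓ a * (G ℓ d * G ℓ b) + G ℓ b * (G ℓ d * G ℓ a))
      + (G ℓ d * (G ℓ a * G ℓ b) + G ℓ d * (G ℓ b * G ℓ a)) = 0 := by
  rcases lt_trichotomy b a with h | h | h
  · exact local_lt ℓ hℓ ha hb hd h
  · subst h
    exact serre_eq (M := Module.End (RatFunc ℚ) Fock) v _ _ (G_sq ℓ b) (G_aba ℓ hℓ ha hd)
  · have := local_lt ℓ hℓ hb ha hd h
    rw [← this]
    abel_nf

/-- The truncated operator. -/
noncomputable def FF (ℓ : ℕ) (i : ZMod ℓ) (K : ℤ) : Module.End (RatFunc ℚ) Fock :=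
  ∑ c ∈ (Finset.Icc (-K) K).filter (fun c : ℤ => (c : ZMod ℓ) = i), G ℓ c

lemma FF_serre (ℓ : ℕ) (hℓ : 3 ≤ ℓ) (i j : ZMod ℓ) (h : j = i + 1 ∨ j = i - 1) (K : ℤ) :
    FF ℓ i K * (FF ℓ i K * FF ℓ j K) - (v + v⁻¹) • (FF ℓ i K * (FF ℓ j K * FF ℓ i K))
      + FF ℓ j K * (FF ℓ i K * FF ℓ i K) = 0 := by
  refine sum_serre (M := Module.End (RatFunc ℚ) Fock) v (G ℓ) _ _ ?_
  intro a ha b hb d hd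
  have ha := (Finset.mem_filter.mp ha).2
  have hb := (Finset.mem_filter.mp hb).2
  have hd := (Finset.mem_filter.mp hd).2
  rcases h with rfl | rfl
  · have hp : ((d - 1 : ℤ) : ZMod ℓ) = i := by push_cast; rw [hd]; ring
    exact local_all ℓ hℓ (p := d - 1) (by rw [ha, hp]) (by rw [hb, hp]) (by omega)
  · have hp : ((d + 1 : ℤ) : ZMod ℓ) = i := by push_cast; rw [hd]; ring
    exact local_all ℓ hℓ (p := d + 1) (by rw [ha, hp]) (by rw [hb, hp]) (by omega)

lemma Fvec_eq (ℓ : ℕ) (i : ZMod ℓ) {K : ℤ} {μ : YoungDiagram} (hK : Bnd K μ) :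
    Fvec ℓ i μ = FF ℓ i K (Finsupp.single μ 1) := by
  have h1 : Fvec ℓ i μ = ∑ᶠ b ∈ A ℓ i μ,
      v ^ (NN ℓ μ (content b)) • Finsupp.single (ad μ (content b)) (1 : RatFunc ℚ) := by
    unfold Fvec
    refine finsum_mem_congr rfl ?_
    rintro b ⟨hb, rfl⟩
    rw [Nl_eq_NN, ad_content μ hb]
  rw [h1, ← finsum_mem_image (g := content) (s := A ℓ i μ)
    (f := fun c => v ^ (NN ℓ μ c) • Finsupp.single (ad μ c) (1 : RatFunc ℚ))
    (fun x hx y hy hxy => addable_content_inj μ hx.1 hy.1 hxy)]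
  have h2 : content '' A ℓ i μ =
      (((Finset.Icc (-K) K).filter (fun c : ℤ => (c : ZMod ℓ) = i)).filter (fun c => Ad μ c) :
        Finset ℤ) := by
    ext x
    simp only [Set.mem_image, A, Set.mem_ofPred_eq, Finset.coe_filter, Finset.mem_filter,
      Finset.mem_Icc, color]
    constructor
    · rintro ⟨b, ⟨hb, hi⟩, rfl⟩
      have := (ad_iff μ (content b)).mpr ⟨b, hb, rfl⟩
      exact ⟨⟨hK.of_ad this, hi⟩, this⟩
    · rintro ⟨⟨-, hi⟩, h⟩
      obtain ⟨b, hb, rfl⟩ := (ad_iff μ x).mp h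
      exact ⟨b, ⟨hb, hi⟩, rfl⟩
  rw [h2, finsum_mem_coe_finset, Finset.sum_filter, FF, LinearMap.sum_apply]
  refine Finset.sum_congr rfl fun c _ => ?_
  rw [G_single, Gvec]

/-- Span of bounded basis vectors. -/
noncomputable def DD (K : ℤ) : Submodule (RatFunc ℚ) Fock :=
  Submodule.span (RatFunc ℚ) ((fun μ => Finsupp.single μ (1 : RatFunc ℚ)) '' {μ | Bnd K μ})

lemma Fop_eq_on (ℓ : ℕ) (i : ZMod ℓ) {K L : ℤ} (hKL : K ≤ L) {x : Fock} (hx : x ∈ DD K) :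
    Fop ℓ i x = FF ℓ i L x := by
  refine LinearMap.eqOn_span (f := Fop ℓ i) (g := FF ℓ i L) ?_ hx
  rintro _ ⟨μ, hμ, rfl⟩
  simp only
  rw [Fop_single, Fvec_eq ℓ i (Bnd.mono hμ hKL)]

lemma FF_mem (ℓ : ℕ) (i : ZMod ℓ) {K L : ℤ} {x : Fock} (hx : x ∈ DD K) :
    FF ℓ i L x ∈ DD (K + 1) := by
  rw [FF, LinearMap.sum_apply]
  refine Submodule.sum_mem _ fun c _ => ?_
  have : DD K ≤ (DD (K + 1)).comap (G ℓ c) := by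
    refine Submodule.span_le.mpr ?_
    rintro _ ⟨μ, hμ, rfl⟩
    simp only [Submodule.comap_coe, Set.mem_preimage, SetLike.mem_coe]
    rw [G_single, Gvec]
    split_ifs with h
    · exact Submodule.smul_mem _ _ (Submodule.subset_span ⟨_, Bnd.ad hμ h, rfl⟩)
    · exact Submodule.zero_mem _
  exact this hx

lemma Fop_triple (ℓ : ℕ) (i j k : ZMod ℓ) {K : ℤ} {x : Fock} (hx : x ∈ DD K) :
    (Fop ℓ i ∘ₗ Fop ℓ j ∘ₗ Fop ℓ k) x
      = (FF ℓ i (K + 2) * (FF ℓ j (K + 2) * FF ℓ k (K + 2))) x := by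
  simp only [LinearMap.comp_apply, Module.End.mul_apply]
  have h1 := FF_mem ℓ k (L := K + 2) hx
  have h2 := FF_mem ℓ j (L := K + 2) h1
  rw [Fop_eq_on ℓ k (L := K + 2) (by omega) hx, Fop_eq_on ℓ j (L := K + 2) (by omega) h1,
    Fop_eq_on ℓ i (L := K + 2) (by omega) h2]

theorem stmt6 (ℓ : ℕ) (hℓ : 3 ≤ ℓ) (i j : ZMod ℓ) (h : j = i + 1 ∨ j = i - 1) :
    Fop ℓ i ∘ₗ Fop ℓ i ∘ₗ Fop ℓ j - (v + v⁻¹) • (Fop ℓ i ∘ₗ Fop ℓ j ∘ₗ Fop ℓ i)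
      + Fop ℓ j ∘ₗ Fop ℓ i ∘ₗ Fop ℓ i = 0 := by
  apply G_ext
  intro μ
  obtain ⟨K, hK⟩ := exists_bnd μ
  have hx : Finsupp.single μ (1 : RatFunc ℚ) ∈ DD K := Submodule.subset_span ⟨μ, hK, rfl⟩
  have := LinearMap.congr_fun (FF_serre ℓ hℓ i j h (K + 2)) (Finsupp.single μ 1)
  rw [LinearMap.add_apply, LinearMap.sub_apply, LinearMap.smul_apply] at this ⊢
  rw [Fop_triple ℓ _ _ _ hx, Fop_triple ℓ _ _ _ hx, Fop_triple ℓ _ _ _ hx]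
  exact this

end MisraMiwa
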